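/- arXiv:2105.06516 — 3 statements merged into one kernel-verified Lean document; each statement's English description precedes it below -/
import Mathlib

section
/- Let $n > 0$, $\Delta t_k > 0$, and let $\Phi(t)$ be the Hill-Clohessy-Wiltshire state transition matrix. Let $e_4 = (0,0,0,1,0,0)^T$. Then $\int_{0}^{\Delta t_k} \Phi(s)\,e_4\,e_4^T\,\Phi(s)^T\,ds$ equals the symmetric $6\times 6$ matrix whose lower-triangular entries are: $(1,1) = \frac{1}{n^2}\zeta_{ss}$; $(2,1) = \frac{2}{n^2}(\zeta_{cs} - \zeta_s)$, $(2,2) = \frac{4}{n^2}(\zeta_{cc} - 2\zeta_c + \Delta t_k)$; row 3 entirely zero; $(4,1) = \frac{1}{n}\zeta_{cs}$, $(4,2) = \frac{2}{n}(\zeta_{cc} - \zeta_c)$, $(4,4) = \zeta_{cc}$; $(5,1) = \frac{-2}{n}\zeta_{ss}$, $(5,2) = \frac{-4}{n}(\zeta_{cs} - \zeta_s)$, $(5,4) = -2\zeta_{cs}$, $(5,5) = 4\zeta_{ss}$; row 6 entirely zero; all other entries involving row/column 3 or 6 are zero. -/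
open MeasureTheory Matrix Real

/-- The integral over `[0, T]` of a product of two trigonometric polynomials of degree one. -/
theorem integral_mul_trig_degree_one {n : ℝ} (hn : n ≠ 0) (T a b c a' b' c' : ℝ) :
    ∫ s in (0:ℝ)..T, (a + b * cos (n * s) + c * sin (n * s)) *
        (a' + b' * cos (n * s) + c' * sin (n * s)) =
      a * a' * T + (a * b' + b * a') * ((1 / n) * sin (n * T))
        + (a * c' + c * a') * ((1 / n) * (1 - cos (n * T)))
        + b * b' * (T / 2 + (1 / (4 * n)) * sin (2 * n * T))
        + c * c' * (T / 2 - (1 / (4 * n)) * sin (2 * n * T))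
        + (b * c' + c * b') * ((1 / (4 * n)) * (1 - cos (2 * n * T))) := by
  have hderiv (x : ℝ) : HasDerivAt (fun t : ℝ =>
      a * a' * t + (a * b' + b * a') * ((1 / n) * sin (n * t))
        + (a * c' + c * a') * ((1 / n) * (1 - cos (n * t)))
        + b * b' * (t / 2 + (1 / (4 * n)) * sin (2 * n * t))
        + c * c' * (t / 2 - (1 / (4 * n)) * sin (2 * n * t))
        + (b * c' + c * b') * ((1 / (4 * n)) * (1 - cos (2 * n * t))))
      ((a + b * cos (n * x) + c * sin (n * x)) *
        (a' + b' * cos (n * x) + c' * sin (n * x))) x := by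
    have hid := hasDerivAt_id' x
    have h₁ := hid.const_mul n
    have h₂ := hid.const_mul (2 * n)
    refine HasDerivAt.congr_deriv ((((((hid.const_mul (a * a')).add
      ((h₁.sin.const_mul (1 / n)).const_mul (a * b' + b * a'))).add
      (((h₁.cos.const_sub 1).const_mul (1 / n)).const_mul (a * c' + c * a'))).add
      (((hid.div_const 2).add (h₂.sin.const_mul (1 / (4 * n)))).const_mul (b * b'))).add
      (((hid.div_const 2).sub (h₂.sin.const_mul (1 / (4 * n)))).const_mul (c * c'))).add
      (((h₂.cos.const_sub 1).const_mul (1 / (4 * n))).const_mul (b * c' + c * b'))) ?_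
    rw [mul_assoc 2 n x, sin_two_mul, cos_two_mul]
    field_simp
    linear_combination -8 * c * c' * sin_sq_add_cos_sq (n * x)
  rw [intervalIntegral.integral_eq_sub_of_hasDerivAt (fun x _ => hderiv x)
    (Continuous.intervalIntegrable (by fun_prop) _ _)]
  simp

theorem hcw_process_noise_covariance_radial
    (n Δt : ℝ) (hn : 0 < n) (hΔt : 0 < Δt)
    (Φ : ℝ → Matrix (Fin 6) (Fin 6) ℝ)
    (hΦ : ∀ t, Φ t =
      !![4 - 3 * cos (n * t), 0, 0, (1 / n) * sin (n * t),
           (2 / n) * (1 - cos (n * t)), 0;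
         6 * (sin (n * t) - n * t), 1, 0, (2 / n) * (cos (n * t) - 1),
           (1 / n) * (4 * sin (n * t) - 3 * n * t), 0;
         0, 0, cos (n * t), 0, 0, (1 / n) * sin (n * t);
         3 * n * sin (n * t), 0, 0, cos (n * t), 2 * sin (n * t), 0;
         6 * n * (cos (n * t) - 1), 0, 0, -2 * sin (n * t), 4 * cos (n * t) - 3, 0;
         0, 0, -n * sin (n * t), 0, 0, cos (n * t)])
    (ζc ζs ζcc ζss ζcs : ℝ)
    (hζc : ζc = (1 / n) * sin (n * Δt))
    (hζs : ζs = (1 / n) * (1 - cos (n * Δt)))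
    (hζcc : ζcc = Δt / 2 + (1 / (4 * n)) * sin (2 * n * Δt))
    (hζss : ζss = Δt / 2 - (1 / (4 * n)) * sin (2 * n * Δt))
    (hζcs : ζcs = (1 / (4 * n)) * (1 - cos (2 * n * Δt))) :
    (Matrix.of fun i j => ∫ s in (0:ℝ)..Δt,
        (Φ s * Matrix.vecMulVec (![0, 0, 0, 1, 0, 0] : Fin 6 → ℝ) (![0, 0, 0, 1, 0, 0] : Fin 6 → ℝ)
          * (Φ s)ᵀ) i j)
      = !![(1 / n ^ 2) * ζss, (2 / n ^ 2) * (ζcs - ζs), 0, (1 / n) * ζcs,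
             (-2 / n) * ζss, 0;
           (2 / n ^ 2) * (ζcs - ζs), (4 / n ^ 2) * (ζcc - 2 * ζc + Δt), 0,
             (2 / n) * (ζcc - ζc), (-4 / n) * (ζcs - ζs), 0;
           0, 0, 0, 0, 0, 0;
           (1 / n) * ζcs, (2 / n) * (ζcc - ζc), 0, ζcc, -2 * ζcs, 0;
           (-2 / n) * ζss, (-4 / n) * (ζcs - ζs), 0, -2 * ζcs, 4 * ζss, 0;
           0, 0, 0, 0, 0, 0] := by
  have hcol (s : ℝ) (i : Fin 6) : (Φ s *ᵥ ![0, 0, 0, 1, 0, 0]) i =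
      ![0, -2 / n, 0, 0, 0, 0] i + ![0, 2 / n, 0, 1, 0, 0] i * cos (n * s)
        + ![1 / n, 0, 0, 0, -2, 0] i * sin (n * s) := by
    rw [hΦ]
    fin_cases i <;> simp [Matrix.mulVec, dotProduct, Fin.sum_univ_succ] <;> ring
  have hentry (s : ℝ) : Φ s * vecMulVec (![0, 0, 0, 1, 0, 0] : Fin 6 → ℝ)
      (![0, 0, 0, 1, 0, 0] : Fin 6 → ℝ) * (Φ s)ᵀ =
      vecMulVec (Φ s *ᵥ ![0, 0, 0, 1, 0, 0]) (Φ s *ᵥ ![0, 0, 0, 1, 0, 0]) := by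
    rw [mul_vecMulVec, vecMulVec_mul, vecMul_transpose]
  ext i j
  simp only [of_apply, hentry, vecMulVec_apply, hcol]
  rw [integral_mul_trig_degree_one hn.ne', ← hζc, ← hζs, ← hζcc, ← hζss, ← hζcs]
  fin_cases i <;> fin_cases j <;> simp [-mul_eq_mul_left_iff, -mul_eq_mul_right_iff]
  all_goals ring
end

section
/- Let $n > 0$, $\Delta t_k > 0$, and let $\Phi(t)$ be the Hill-Clohessy-Wiltshire state transition matrix. Let $e_5 = (0,0,0,0,1,0)^T$. Then $\int_{0}^{\Delta t_k} \Phi(s)\,e_5\,e_5^T\,\Phi(s)^T\,ds$ equals the symmetric $6\times 6$ matrix whose lower-triangular entries are: $(1,1) = \frac{4}{n^2}(\Delta t_k + \zeta_{cc} - 2\zeta_c)$; $(2,1) = \frac{2}{n^2}(3n\zeta_{tc} - 4\zeta_{cs} + 4\zeta_s - \frac{3n}{2}\Delta t_k^2)$, $(2,2) = \frac{1}{n^2}(3n^2\Delta t_k^3 + 16\zeta_{ss} - 24 n \zeta_{ts})$; row 3 entirely zero; $(4,1) = \frac{4}{n}(\zeta_s - \zeta_{cs})$, $(4,2) = \frac{2}{n}(4\zeta_{ss}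 - 3n\zeta_{ts})$, $(4,4) = 4\zeta_{ss}$; $(5,1) = \frac{2}{n}(7\zeta_c - 4\zeta_{cc} - 3\Delta t_k)$, $(5,2) = \frac{1}{n}(16\zeta_{cs} - 12 n \zeta_{tc} - 12\zeta_s + \frac{9n}{2}\Delta t_k^2)$, $(5,4) = 8\zeta_{cs} - 6\zeta_s$, $(5,5) = 9\Delta t_k + 16\zeta_{cc} - 24\zeta_c$; row 6 entirely zero. -/
open MeasureTheory Matrix Real

/-- The integral over `[0, T]` of a linear combination of `1`, `s`, `s ^ 2`, `cos (n s)`, `sin (n s)`,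
their quadratic products, and `s cos (n s)`, `s sin (n s)`. -/
theorem integral_trig_combination {n : ℝ} (hn : n ≠ 0)
    (T a₀ a₁ a₂ bc bs ccc css ccs dc ds : ℝ) :
    ∫ s in (0 : ℝ)..T, (a₀ + a₁ * s + a₂ * s ^ 2 + bc * cos (n * s) + bs * sin (n * s)
        + ccc * cos (n * s) ^ 2 + css * sin (n * s) ^ 2 + ccs * (cos (n * s) * sin (n * s))
        + dc * (s * cos (n * s)) + ds * (s * sin (n * s)))
      = a₀ * T + a₁ * (T ^ 2 / 2) + a₂ * (T ^ 3 / 3)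
        + bc * ((1 / n) * sin (n * T)) + bs * ((1 / n) * (1 - cos (n * T)))
        + ccc * (T / 2 + (1 / (4 * n)) * sin (2 * n * T))
        + css * (T / 2 - (1 / (4 * n)) * sin (2 * n * T))
        + ccs * ((1 / (4 * n)) * (1 - cos (2 * n * T)))
        + dc * ((1 / n ^ 2) * (cos (n * T) - 1) + (T / n) * sin (n * T))
        + ds * ((-T / n) * cos (n * T) + (1 / n ^ 2) * sin (n * T)) := by
  have hlin (m s : ℝ) : HasDerivAt (fun x => m * x) m s := by
    simpa using (hasDerivAt_id s).const_mul m
  have hderiv (s : ℝ) : HasDerivAt (fun T : ℝ => a₀ * T + a₁ * (T ^ 2 / 2) + a₂ * (T ^ 3 / 3)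
        + bc * ((1 / n) * sin (n * T)) + bs * ((1 / n) * (1 - cos (n * T)))
        + ccc * (T / 2 + (1 / (4 * n)) * sin (2 * n * T))
        + css * (T / 2 - (1 / (4 * n)) * sin (2 * n * T))
        + ccs * ((1 / (4 * n)) * (1 - cos (2 * n * T)))
        + dc * ((1 / n ^ 2) * (cos (n * T) - 1) + (T / n) * sin (n * T))
        + ds * ((-T / n) * cos (n * T) + (1 / n ^ 2) * sin (n * T)))
      (a₀ + a₁ * s + a₂ * s ^ 2 + bc * cos (n * s) + bs * sin (n * s)
        + ccc * cos (n * s) ^ 2 + css * sin (n * s) ^ 2 + ccs * (cos (n * s) * sin (n * s))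
        + dc * (s * cos (n * s)) + ds * (s * sin (n * s))) s := by
    have hid := hasDerivAt_id' s
    have hsin := (hlin n s).sin
    have hcos := (hlin n s).cos
    have hsin₂ := (hlin (2 * n) s).sin
    have hcos₂ := (hlin (2 * n) s).cos
    have h := (((((((((hid.const_mul a₀).add
      (((hid.pow 2).div_const 2).const_mul a₁)).add
      (((hid.pow 3).div_const 3).const_mul a₂)).add
      ((hsin.const_mul (1 / n)).const_mul bc)).add
      (((hcos.const_sub 1).const_mul (1 / n)).const_mul bs)).add
      (((hid.div_const 2).add (hsin₂.const_mul (1 / (4 * n)))).const_mul ccc)).add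
      (((hid.div_const 2).sub (hsin₂.const_mul (1 / (4 * n)))).const_mul css)).add
      (((hcos₂.const_sub 1).const_mul (1 / (4 * n))).const_mul ccs)).add
      ((((hcos.sub_const 1).const_mul (1 / n ^ 2)).add
        ((hid.div_const n).mul hsin)).const_mul dc)).add
      (((((hasDerivAt_neg' s).div_const n).mul hcos).add (hsin.const_mul (1 / n ^ 2))).const_mul ds)
    refine h.congr_deriv ?_
    have hs : sin (2 * n * s) = 2 * sin (n * s) * cos (n * s) := by
      rw [mul_assoc, sin_two_mul]
    have hc : cos (2 * n * s) = 2 * cos (n * s) ^ 2 - 1 := by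
      rw [mul_assoc, cos_two_mul]
    rw [hs, hc, sin_sq]
    field_simp
    ring
  rw [intervalIntegral.integral_eq_sub_of_hasDerivAt (fun s _ => hderiv s)
    (Continuous.intervalIntegrable (by fun_prop) _ _)]
  simp

theorem mul_vecMulVec_mul_transpose_apply {m k : Type*} [Fintype k]
    (A : Matrix m k ℝ) (v : k → ℝ) (i j : m) :
    (A * vecMulVec v v * Aᵀ) i j = (A *ᵥ v) i * (A *ᵥ v) j := by
  rw [mul_vecMulVec, vecMulVec_mul, vecMul_transpose, vecMulVec_apply]

theorem hcw_process_noise_covariance_transverse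
    (n Δt : ℝ) (hn : 0 < n) (hΔt : 0 < Δt)
    (Φ : ℝ → Matrix (Fin 6) (Fin 6) ℝ)
    (hΦ : ∀ t, Φ t =
      !![4 - 3 * cos (n * t), 0, 0, (1 / n) * sin (n * t),
           (2 / n) * (1 - cos (n * t)), 0;
         6 * (sin (n * t) - n * t), 1, 0, (2 / n) * (cos (n * t) - 1),
           (1 / n) * (4 * sin (n * t) - 3 * n * t), 0;
         0, 0, cos (n * t), 0, 0, (1 / n) * sin (n * t);
         3 * n * sin (n * t), 0, 0, cos (n * t), 2 * sin (n * t), 0;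
         6 * n * (cos (n * t) - 1), 0, 0, -2 * sin (n * t), 4 * cos (n * t) - 3, 0;
         0, 0, -n * sin (n * t), 0, 0, cos (n * t)])
    (ζc ζs ζcc ζss ζcs ζtc ζts : ℝ)
    (hζc : ζc = (1 / n) * sin (n * Δt))
    (hζs : ζs = (1 / n) * (1 - cos (n * Δt)))
    (hζcc : ζcc = Δt / 2 + (1 / (4 * n)) * sin (2 * n * Δt))
    (hζss : ζss = Δt / 2 - (1 / (4 * n)) * sin (2 * n * Δt))
    (hζcs : ζcs = (1 / (4 * n)) * (1 - cos (2 * n * Δt)))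
    (hζtc : ζtc = (1 / n ^ 2) * (cos (n * Δt) - 1) + (Δt / n) * sin (n * Δt))
    (hζts : ζts = (-Δt / n) * cos (n * Δt) + (1 / n ^ 2) * sin (n * Δt)) :
    (Matrix.of fun i j => ∫ s in (0:ℝ)..Δt,
        (Φ s * Matrix.vecMulVec (![0, 0, 0, 0, 1, 0] : Fin 6 → ℝ)
          (![0, 0, 0, 0, 1, 0] : Fin 6 → ℝ) * (Φ s)ᵀ) i j)
      = !![(4 / n ^ 2) * (Δt + ζcc - 2 * ζc),
             (2 / n ^ 2) * (3 * n * ζtc - 4 * ζcs + 4 * ζs - (3 * n / 2) * Δt ^ 2),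
             0, (4 / n) * (ζs - ζcs), (2 / n) * (7 * ζc - 4 * ζcc - 3 * Δt), 0;
           (2 / n ^ 2) * (3 * n * ζtc - 4 * ζcs + 4 * ζs - (3 * n / 2) * Δt ^ 2),
             (1 / n ^ 2) * (3 * n ^ 2 * Δt ^ 3 + 16 * ζss - 24 * n * ζts),
             0, (2 / n) * (4 * ζss - 3 * n * ζts),
             (1 / n) * (16 * ζcs - 12 * n * ζtc - 12 * ζs + (9 * n / 2) * Δt ^ 2), 0;
           0, 0, 0, 0, 0, 0;
           (4 / n) * (ζs - ζcs), (2 / n) * (4 * ζss - 3 * n * ζts), 0,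
             4 * ζss, 8 * ζcs - 6 * ζs, 0;
           (2 / n) * (7 * ζc - 4 * ζcc - 3 * Δt),
             (1 / n) * (16 * ζcs - 12 * n * ζtc - 12 * ζs + (9 * n / 2) * Δt ^ 2), 0,
             8 * ζcs - 6 * ζs, 9 * Δt + 16 * ζcc - 24 * ζc, 0;
           0, 0, 0, 0, 0, 0] := by
  have hn₀ : n ≠ 0 := hn.ne'
  have hint := integral_trig_combination hn₀ Δt
  simp only [← hζc, ← hζs, ← hζcc, ← hζss, ← hζcs, ← hζtc, ← hζts] at hint
  have hcol (s : ℝ) : Φ s *ᵥ ![0, 0, 0, 0, 1, 0] =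
      ![(2 / n) * (1 - cos (n * s)), (1 / n) * (4 * sin (n * s) - 3 * n * s), 0,
        2 * sin (n * s), 4 * cos (n * s) - 3, 0] := by
    rw [hΦ]
    ext i
    fin_cases i <;> simp [mulVec, dotProduct, Fin.sum_univ_six]
  simp only [mul_vecMulVec_mul_transpose_apply, hcol]
  have h_x_x : ∫ s in (0 : ℝ)..Δt, ((2 / n) * (1 - cos (n * s))) *
      ((2 / n) * (1 - cos (n * s))) =
      (4 / n ^ 2) * (Δt + ζcc - 2 * ζc) := by
    refine Eq.trans (intervalIntegral.integral_congr fun s _ => ?_)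
      ((hint (4 / n ^ 2) 0 0 (-8 / n ^ 2) 0 (4 / n ^ 2) 0 0 0 0).trans ?_)
    all_goals field_simp
    all_goals ring
  have h_x_y : ∫ s in (0 : ℝ)..Δt, ((2 / n) * (1 - cos (n * s))) *
      ((1 / n) * (4 * sin (n * s) - 3 * n * s)) =
      (2 / n ^ 2) * (3 * n * ζtc - 4 * ζcs + 4 * ζs - (3 * n / 2) * Δt ^ 2) := by
    refine Eq.trans (intervalIntegral.integral_congr fun s _ => ?_)
      ((hint 0 (-6 / n) 0 0 (8 / n ^ 2) 0 0 (-8 / n ^ 2) (6 / n) 0).trans ?_)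
    all_goals field_simp
    all_goals ring
  have h_x_xd : ∫ s in (0 : ℝ)..Δt, ((2 / n) * (1 - cos (n * s))) *
      (2 * sin (n * s)) =
      (4 / n) * (ζs - ζcs) := by
    refine Eq.trans (intervalIntegral.integral_congr fun s _ => ?_)
      ((hint 0 0 0 0 (4 / n) 0 0 (-4 / n) 0 0).trans ?_)
    all_goals field_simp
    all_goals ring
  have h_x_yd : ∫ s in (0 : ℝ)..Δt, ((2 / n) * (1 - cos (n * s))) *
      (4 * cos (n * s) - 3) =
      (2 / n) * (7 * ζc - 4 * ζcc - 3 * Δt) := by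
    refine Eq.trans (intervalIntegral.integral_congr fun s _ => ?_)
      ((hint (-6 / n) 0 0 (14 / n) 0 (-8 / n) 0 0 0 0).trans ?_)
    all_goals field_simp
    all_goals ring
  have h_y_y : ∫ s in (0 : ℝ)..Δt, ((1 / n) * (4 * sin (n * s) - 3 * n * s)) *
      ((1 / n) * (4 * sin (n * s) - 3 * n * s)) =
      (1 / n ^ 2) * (3 * n ^ 2 * Δt ^ 3 + 16 * ζss - 24 * n * ζts) := by
    refine Eq.trans (intervalIntegral.integral_congr fun s _ => ?_)
      ((hint 0 0 9 0 0 0 (16 / n ^ 2) 0 0 (-24 / n)).trans ?_)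
    all_goals field_simp
    all_goals ring
  have h_y_xd : ∫ s in (0 : ℝ)..Δt, ((1 / n) * (4 * sin (n * s) - 3 * n * s)) *
      (2 * sin (n * s)) =
      (2 / n) * (4 * ζss - 3 * n * ζts) := by
    refine Eq.trans (intervalIntegral.integral_congr fun s _ => ?_)
      ((hint 0 0 0 0 0 0 (8 / n) 0 0 (-6)).trans ?_)
    all_goals field_simp
    all_goals ring
  have h_y_yd : ∫ s in (0 : ℝ)..Δt, ((1 / n) * (4 * sin (n * s) - 3 * n * s)) *
      (4 * cos (n * s) - 3) =
      (1 / n) * (16 * ζcs - 12 * n * ζtc - 12 * ζs + (9 * n / 2) * Δt ^ 2) := by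
    refine Eq.trans (intervalIntegral.integral_congr fun s _ => ?_)
      ((hint 0 9 0 0 (-12 / n) 0 0 (16 / n) (-12) 0).trans ?_)
    all_goals field_simp
    all_goals ring
  have h_xd_xd : ∫ s in (0 : ℝ)..Δt, (2 * sin (n * s)) *
      (2 * sin (n * s)) =
      4 * ζss := by
    refine Eq.trans (intervalIntegral.integral_congr fun s _ => ?_)
      ((hint 0 0 0 0 0 0 4 0 0 0).trans ?_)
    all_goals field_simp
    all_goals ring
  have h_xd_yd : ∫ s in (0 : ℝ)..Δt, (2 * sin (n * s)) *
      (4 * cos (n * s) - 3) =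
      8 * ζcs - 6 * ζs := by
    refine Eq.trans (intervalIntegral.integral_congr fun s _ => ?_)
      ((hint 0 0 0 0 (-6) 0 0 8 0 0).trans ?_)
    all_goals field_simp
    all_goals ring
  have h_yd_yd : ∫ s in (0 : ℝ)..Δt, (4 * cos (n * s) - 3) *
      (4 * cos (n * s) - 3) =
      9 * Δt + 16 * ζcc - 24 * ζc := by
    refine Eq.trans (intervalIntegral.integral_congr fun s _ => ?_)
      ((hint 9 0 0 (-24) 0 16 0 0 0 0).trans ?_)
    all_goals field_simp
    all_goals ring
  ext i j
  fin_cases i <;> fin_cases j <;>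
    first
    | exact h_x_x
    | exact h_x_y
    | exact (intervalIntegral.integral_congr fun s _ => mul_comm _ _).trans h_x_y
    | exact h_x_xd
    | exact (intervalIntegral.integral_congr fun s _ => mul_comm _ _).trans h_x_xd
    | exact h_x_yd
    | exact (intervalIntegral.integral_congr fun s _ => mul_comm _ _).trans h_x_yd
    | exact h_y_y
    | exact h_y_xd
    | exact (intervalIntegral.integral_congr fun s _ => mul_comm _ _).trans h_y_xd
    | exact h_y_yd
    | exact (intervalIntegral.integral_congr fun s _ => mul_comm _ _).trans h_y_yd
    | exact h_xd_xd
    | exact h_xd_yd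
    | exact (intervalIntegral.integral_congr fun s _ => mul_comm _ _).trans h_xd_yd
    | exact h_yd_yd
    | simp
end

section
/- Let $\bar{n} > 0$, $p > 0$, $\mu > 0$, $L = \sqrt{\mu p}$, $h, k \in \mathbb{R}$, $t_{k-1} < t_k$ with $\Delta t_k = t_k - t_{k-1}$, let $l(\tau) = l_{k-1} + \bar{n}(\tau - t_{k-1})$ and $l_k = l(t_k)$. Define $\gamma_n(\tau) = \left(0,\ 0,\ 0,\ \tfrac{1}{2}\sqrt{p/\mu}(1+h^2+k^2)\cos l(\tau),\ \tfrac{1}{2}\sqrt{p/\mu}(1+h^2+k^2)\sin l(\tau),\ -\tfrac{L}{\mu}(k\cos l(\tau) - h\sin l(\tau))\right)^T \in \mathbb{R}^6$. Then $\int_{t_{k-1}}^{t_k} \gamma_n(\tau)\,\gamma_n(\tau)^T\,d\tau$ is the symmetric $6\times 6$ matrix, zero outside rows/columns 4-6, with lower-triangular entries $(4,4) = c^2\,\bar{\zeta}_{cc}$, $(5,4) = c^2\,\bar{\zeta}_{cs}$, $(5,5) = c^2\,\bar{\zeta}_{ss}$, $(6,4) = -\tfrac{L}{\mu} c\,(k\bar{\zeta}_{cc}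 - h\bar{\zeta}_{cs})$, $(6,5) = -\tfrac{L}{\mu} c\,(k\bar{\zeta}_{cs} - h\bar{\zeta}_{ss})$, $(6,6) = \tfrac{L^2}{\mu^2}(k^2\bar{\zeta}_{cc} + h^2\bar{\zeta}_{ss} - 2kh\bar{\zeta}_{cs})$, where $c = \tfrac{1}{2}\sqrt{p/\mu}(1+h^2+k^2)$, $\bar{\zeta}_{cc} = \frac{\Delta t_k}{2} + \frac{1}{4\bar{n}}(\sin 2l_k - \sin 2l_{k-1})$, $\bar{\zeta}_{ss} = \frac{\Delta t_k}{2} - \frac{1}{4\bar{n}}(\sin 2l_k - \sin 2l_{k-1})$, $\bar{\zeta}_{cs} = -\frac{1}{4\bar{n}}(\cos 2l_k - \cos 2l_{k-1})$. -/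
open MeasureTheory Matrix Real

/-- The integral of the product of two sinusoids in the phase `l₀ + n * (τ - a)`. -/
theorem integral_sinusoid_mul_sinusoid {n : ℝ} (hn : n ≠ 0) (a b l₀ x y x' y' : ℝ) :
    ∫ τ in a..b, (x * cos (l₀ + n * (τ - a)) + y * sin (l₀ + n * (τ - a))) *
        (x' * cos (l₀ + n * (τ - a)) + y' * sin (l₀ + n * (τ - a))) =
      x * x' * ((b - a) / 2 +
          1 / (4 * n) * (sin (2 * (l₀ + n * (b - a))) - sin (2 * l₀))) +
        (x * y' + y * x') *
          (-(1 / (4 * n)) * (cos (2 * (l₀ + n * (b - a))) - cos (2 * l₀))) +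
        y * y' * ((b - a) / 2 -
          1 / (4 * n) * (sin (2 * (l₀ + n * (b - a))) - sin (2 * l₀))) := by
  have hderiv : ∀ τ ∈ Set.uIcc a b, HasDerivAt (fun τ =>
      x * x' * (τ / 2 + 1 / (4 * n) * sin (2 * (l₀ + n * (τ - a)))) +
        (x * y' + y * x') * (-(1 / (4 * n)) * cos (2 * (l₀ + n * (τ - a)))) +
        y * y' * (τ / 2 - 1 / (4 * n) * sin (2 * (l₀ + n * (τ - a)))))
      ((x * cos (l₀ + n * (τ - a)) + y * sin (l₀ + n * (τ - a))) *
        (x' * cos (l₀ + n * (τ - a)) + y' * sin (l₀ + n * (τ - a)))) τ := by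
    intro τ _
    have hphase : HasDerivAt (fun τ => 2 * (l₀ + n * (τ - a))) (2 * (n * 1)) τ :=
      ((((hasDerivAt_id τ).sub_const a).const_mul n).const_add l₀).const_mul 2
    have hhalf : HasDerivAt (fun τ : ℝ => τ / 2) (1 / 2) τ := (hasDerivAt_id τ).div_const 2
    have hsin := hphase.sin.const_mul (1 / (4 * n))
    have hcos := hphase.cos.const_mul (-(1 / (4 * n)))
    refine ((((hhalf.add hsin).const_mul (x * x')).add
      (hcos.const_mul (x * y' + y * x'))).add
      ((hhalf.sub hsin).const_mul (y * y'))).congr_deriv ?_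
    rw [sin_two_mul, cos_two_mul]
    field_simp
    linear_combination (-8 * y * y') * sin_sq_add_cos_sq (l₀ + n * (τ - a))
  rw [intervalIntegral.integral_eq_sub_of_hasDerivAt hderiv
    (Continuous.intervalIntegrable (by fun_prop) a b)]
  simp only [sub_self, mul_zero, add_zero]
  ring

theorem equinoctial_process_noise_covariance_normal
    (nbar p μ L h k tkm1 tk lkm1 : ℝ)
    (hn : 0 < nbar) (hp : 0 < p) (hμ : 0 < μ) (ht : tkm1 < tk)
    (hL : L = Real.sqrt (μ * p))
    (Δt : ℝ) (hΔt : Δt = tk - tkm1)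
    (l : ℝ → ℝ) (hl : ∀ τ, l τ = lkm1 + nbar * (τ - tkm1))
    (lk : ℝ) (hlk : lk = l tk)
    (c : ℝ) (hc : c = (1 / 2) * Real.sqrt (p / μ) * (1 + h ^ 2 + k ^ 2))
    (ζcc ζss ζcs : ℝ)
    (hζcc : ζcc = Δt / 2 + (1 / (4 * nbar)) * (sin (2 * lk) - sin (2 * lkm1)))
    (hζss : ζss = Δt / 2 - (1 / (4 * nbar)) * (sin (2 * lk) - sin (2 * lkm1)))
    (hζcs : ζcs = -(1 / (4 * nbar)) * (cos (2 * lk) - cos (2 * lkm1)))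
    (γn : ℝ → Fin 6 → ℝ)
    (hγn : ∀ τ, γn τ =
      ![0, 0, 0, c * cos (l τ), c * sin (l τ),
        -(L / μ) * (k * cos (l τ) - h * sin (l τ))]) :
    (Matrix.of fun i j => ∫ τ in tkm1..tk, Matrix.vecMulVec (γn τ) (γn τ) i j)
      = !![0, 0, 0, 0, 0, 0;
           0, 0, 0, 0, 0, 0;
           0, 0, 0, 0, 0, 0;
           0, 0, 0, c ^ 2 * ζcc, c ^ 2 * ζcs, -(L / μ) * c * (k * ζcc - h * ζcs);
           0, 0, 0, c ^ 2 * ζcs, c ^ 2 * ζss, -(L / μ) * c * (k * ζcs - h * ζss);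
           0, 0, 0, -(L / μ) * c * (k * ζcc - h * ζcs),
             -(L / μ) * c * (k * ζcs - h * ζss),
             (L ^ 2 / μ ^ 2) * (k ^ 2 * ζcc + h ^ 2 * ζss - 2 * k * h * ζcs)] := by
  subst hL hΔt hlk
  have hγ : ∀ τ i, γn τ i =
      (![0, 0, 0, c, 0, -(√(μ * p) / μ) * k] : Fin 6 → ℝ) i * cos (lkm1 + nbar * (τ - tkm1)) +
        (![0, 0, 0, 0, c, √(μ * p) / μ * h] : Fin 6 → ℝ) i *
          sin (lkm1 + nbar * (τ - tkm1)) := by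
    intro τ i
    rw [hγn, hl]
    fin_cases i <;> simp
    ring
  rw [hl] at hζcc hζss hζcs
  ext i j
  simp only [Matrix.of_apply, Matrix.vecMulVec_apply, hγ]
  rw [integral_sinusoid_mul_sinusoid hn.ne', ← hζcc, ← hζss, ← hζcs]
  clear hζcc hζss hζcs
  fin_cases i <;> fin_cases j <;> simp [-mul_eq_mul_left_iff, -mul_eq_mul_right_iff] <;> ring
end
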